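/- Let L be a left bialgebroid over B. For any U ∈ C¹(L,B), the map ∂U(X,Y) := U⁻¹(X₍₁₎ t(U⁻¹(Y₍₁₎))) U(X₍₂₎Y₍₂₎) is a 2-cocycle in Z²(L,B). More generally, if Γ ∈ Z²(L,B) and U ∈ C¹(L,B), then Γ^U(X,Y) := U⁻¹(X₍₁₎ t(U⁻¹(Y₍₁₎))) Γ(X₍₂₎, Y₍₂₎) U(X₍₃₎Y₍₃₎) is again a 2-cocycle in Z²(L,B). -/

import Mathlib

open scoped TensorProduct
open TensorProduct

noncomputable section
attribute [local instance] Classical.propDecidable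

/-- Choice-based lift of a (bilinear) function to the tensor product: if a linear map agreeing
with `f` on pure tensors exists, this is it (it is then unique); otherwise `0`. -/
def tlift (R : Type*) [CommRing R] {M N Q : Type*} [AddCommGroup M] [Module R M]
    [AddCommGroup N] [Module R N] [AddCommGroup Q] [Module R Q]
    (f : M → N → Q) : M ⊗[R] N →ₗ[R] Q :=
  if h : ∃ F : M ⊗[R] N →ₗ[R] Q, ∀ x y, F (x ⊗ₜ[R] y) = f x y then h.choose else 0

/-- Choice-based lift of a (bilinear, balanced) function to a quotient of the tensor product. -/
def qtlift (R : Type*) [CommRing R] {M N Q : Type*} [AddCommGroup M] [Module R M]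
    [AddCommGroup N] [Module R N] [AddCommGroup Q] [Module R Q]
    (p : Submodule R (M ⊗[R] N)) (f : M → N → Q) : ((M ⊗[R] N) ⧸ p) →ₗ[R] Q :=
  if h : ∃ F : ((M ⊗[R] N) ⧸ p) →ₗ[R] Q,
      ∀ x y, F (Submodule.Quotient.mk (x ⊗ₜ[R] y)) = f x y then h.choose else 0

variable (k : Type*) [Field k]

/-- Source and target data for a left bialgebroid over `B`: an algebra map `s : B → L` and an
anti-algebra map `t : B → L` with commuting ranges. -/
structure BgdST (B L : Type*) [Ring B] [Algebra k B] [Ring L] [Algebra k L] where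
  s : B →ₐ[k] L
  t : B →ₗ[k] L
  t_one : t 1 = 1
  t_mul : ∀ a b : B, t (a * b) = t b * t a
  st_comm : ∀ a b : B, s a * t b = t b * s a

namespace BgdST

variable {k} {B L : Type*} [Ring B] [Algebra k B] [Ring L] [Algebra k L]
variable (st : BgdST k B L)

/-- The relations defining `L ⊗_B L`: `t a · X ⊗ Y  ~  X ⊗ s a · Y`. -/
def rel : Submodule k (L ⊗[k] L) :=
  Submodule.span k {z | ∃ (a : B) (X Y : L), z = (st.t a * X) ⊗ₜ[k] Y - X ⊗ₜ[k] (st.s a * Y)}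

/-- `L ⊗_B L` (the coring tensor square). -/
abbrev T2 := (L ⊗[k] L) ⧸ st.rel

/-- Class of a pure tensor in `L ⊗_B L`. -/
def mk2 (X Y : L) : st.T2 := Submodule.Quotient.mk (X ⊗ₜ[k] Y)

/-- Evaluate a balanced bilinear expression on an element of `L ⊗_B L`. -/
def lift2 {Q : Type*} [AddCommGroup Q] [Module k Q] (f : L → L → Q) : st.T2 →ₗ[k] Q :=
  qtlift k st.rel f

/-- The relations defining `L ⊗_{B^{op}} L`: `X·t a ⊗ Y ~ X ⊗ t a · Y`. -/
def relOp : Submodule k (L ⊗[k] L) :=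
  Submodule.span k {z | ∃ (a : B) (X Y : L), z = (X * st.t a) ⊗ₜ[k] Y - X ⊗ₜ[k] (st.t a * Y)}

/-- `L ⊗_{B^{op}} L` (domain of the canonical map `λ`). -/
abbrev TOp := (L ⊗[k] L) ⧸ st.relOp

def mkOp (X Y : L) : st.TOp := Submodule.Quotient.mk (X ⊗ₜ[k] Y)

def liftOp {Q : Type*} [AddCommGroup Q] [Module k Q] (f : L → L → Q) : st.TOp →ₗ[k] Q :=
  qtlift k st.relOp f

/-- The relations defining `L ⊗^{B^{op}} L`: `s a · X ⊗ Y ~ X ⊗ Y · s a`. -/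
def relA : Submodule k (L ⊗[k] L) :=
  Submodule.span k {z | ∃ (a : B) (X Y : L), z = (st.s a * X) ⊗ₜ[k] Y - X ⊗ₜ[k] (Y * st.s a)}

/-- `L ⊗^{B^{op}} L` (domain of the canonical map `μ`). -/
abbrev TA := (L ⊗[k] L) ⧸ st.relA

def mkA (X Y : L) : st.TA := Submodule.Quotient.mk (X ⊗ₜ[k] Y)

def liftA {Q : Type*} [AddCommGroup Q] [Module k Q] (f : L → L → Q) : st.TA →ₗ[k] Q :=
  qtlift k st.relA f

/-- Relations for the triple tensor `L ⊗_B L ⊗_B L`. -/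
def rel3 : Submodule k (L ⊗[k] (L ⊗[k] L)) :=
  Submodule.span k
    ({z | ∃ (a : B) (X Y Z : L),
        z = (st.t a * X) ⊗ₜ[k] (Y ⊗ₜ[k] Z) - X ⊗ₜ[k] ((st.s a * Y) ⊗ₜ[k] Z)} ∪
     {z | ∃ (a : B) (X Y Z : L),
        z = X ⊗ₜ[k] ((st.t a * Y) ⊗ₜ[k] Z) - X ⊗ₜ[k] (Y ⊗ₜ[k] (st.s a * Z))})

/-- `L ⊗_B L ⊗_B L`. -/
abbrev T3 := (L ⊗[k] (L ⊗[k] L)) ⧸ st.rel3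

def mk3 (X Y Z : L) : st.T3 := Submodule.Quotient.mk (X ⊗ₜ[k] (Y ⊗ₜ[k] Z))

/-- The factorwise product of two elements of `L ⊗_B L`, whenever it is well defined
on representatives (as it is when the left factor lies in the Takeuchi product);
junk value `0` otherwise. -/
def mulT2 (z w : st.T2) : st.T2 :=
  if h : ∃ u : st.T2, ∀ zr wr : L ⊗[k] L, Submodule.Quotient.mk zr = z →
      Submodule.Quotient.mk wr = w → Submodule.Quotient.mk (zr * wr) = u
  then h.choose else 0

variable (cop : L →ₗ[k] st.T2) (cou : L →ₗ[k] B)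

/-- The axioms of a left bialgebroid over `B` with structure `(s,t,Δ,ε) = (st.s, st.t, cop, cou)`
(Definition 2.3 of the paper): `L` is a `B^e`-ring and a `B`-coring, the coproduct corestricts
to an algebra map into the Takeuchi product, and the counit is a left character. -/
structure IsLeftBialgebroid : Prop where
  comul_one : cop 1 = st.mk2 1 1
  comul_mul : ∀ X Y : L, cop (X * Y) = st.mulT2 (cop X) (cop Y)
  comul_s : ∀ (b : B) (X : L),
    cop (st.s b * X) = st.lift2 (fun x y => st.mk2 (st.s b * x) y) (cop X)
  comul_t : ∀ (b : B) (X : L),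
    cop (st.t b * X) = st.lift2 (fun x y => st.mk2 x (st.t b * y)) (cop X)
  takeuchi : ∀ (b : B) (X : L),
    st.lift2 (fun x y => st.mk2 (x * st.t b) y) (cop X) =
      st.lift2 (fun x y => st.mk2 x (y * st.s b)) (cop X)
  coassoc : ∀ X : L,
    st.lift2 (fun x1 x2 => st.lift2 (fun y1 y2 => st.mk3 x1 y1 y2) (cop x2)) (cop X) =
      st.lift2 (fun x12 x3 => st.lift2 (fun x1 x2 => st.mk3 x1 x2 x3) (cop x12)) (cop X)
  counit_comul_left : ∀ X : L, st.lift2 (fun x1 x2 => st.s (cou x1) * x2) (cop X) = X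
  counit_comul_right : ∀ X : L, st.lift2 (fun x1 x2 => st.t (cou x2) * x1) (cop X) = X
  counit_one : cou 1 = 1
  counit_s : ∀ (b : B) (X : L), cou (st.s b * X) = b * cou X
  counit_t : ∀ (b : B) (X : L), cou (st.t b * X) = cou X * b
  counit_char_s : ∀ X Y : L, cou (X * st.s (cou Y)) = cou (X * Y)
  counit_char_t : ∀ X Y : L, cou (X * st.t (cou Y)) = cou (X * Y)

/-- The canonical map `λ : L ⊗_{B^{op}} L → L ⊗_B L`, `X ⊗ Y ↦ X₍₁₎ ⊗ X₍₂₎Y`. -/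
def lam : st.TOp →ₗ[k] st.T2 :=
  st.liftOp (fun X Y => st.lift2 (fun x1 x2 => st.mk2 x1 (x2 * Y)) (cop X))

/-- A left bialgebroid is a left Hopf algebroid if `λ` is bijective. -/
def IsLeftHopf : Prop := Function.Bijective (st.lam cop)

/-- The canonical map `μ : L ⊗^{B^{op}} L → L ⊗_B L`, `X ⊗ Y ↦ Y₍₁₎X ⊗ Y₍₂₎`. -/
def mu : st.TA →ₗ[k] st.T2 :=
  st.liftA (fun X Y => st.lift2 (fun y1 y2 => st.mk2 (y1 * X) y2) (cop Y))

/-- A left bialgebroid is an anti-left Hopf algebroid if `μ` is bijective. -/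
def IsAntiLeftHopf : Prop := Function.Bijective (st.mu cop)

/-- `X₊ ⊗_{B^{op}} X₋ := λ⁻¹(X ⊗_B 1)` (meaningful when `λ` is bijective). -/
def plusMinus (X : L) : st.TOp := Function.invFun (st.lam cop) (st.mk2 X 1)

/-- `X₍₋₎ ⊗^{B^{op}} X₍₊₎ := μ⁻¹(1 ⊗_B X)` (meaningful when `μ` is bijective). -/
def minusPlus (X : L) : st.TA := Function.invFun (st.mu cop) (st.mk2 1 X)

/-- A left bisection of a left bialgebroid (Definition 3.1). -/
structure IsLeftBisection (σ : L →ₗ[k] B) : Prop where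
  unital : σ 1 = 1
  t_prop : ∀ (b : B) (X : L), σ (st.t b * X) = σ X * b
  s_mul : ∀ a b : B, σ (st.s (a * b)) = σ (st.s a) * σ (st.s b)
  s_bij : Function.Bijective (fun b => σ (st.s b))
  prod_t : ∀ X Y : L, σ (X * Y) = σ (X * st.t (σ Y))
  prod_s : ∀ X Y : L,
    σ (X * Y) = σ (X * st.s (Function.invFun (fun b => σ (st.s b)) (σ Y)))

/-- Convolution of left bisections:  `(σ * η)(X) := σ(s(η(X₍₁₎)) X₍₂₎)`. -/
def bconv (σ η : L →ₗ[k] B) : L →ₗ[k] B :=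
  (st.lift2 (fun x1 x2 => σ (st.s (η x1) * x2))).comp cop

/-- A right bisection of a left bialgebroid (Definition 3.6). -/
structure IsRightBisection (σ : L →ₗ[k] B) : Prop where
  unital : σ 1 = 1
  s_prop : ∀ (b : B) (X : L), σ (st.s b * X) = b * σ X
  t_mul : ∀ a b : B, σ (st.t (a * b)) = σ (st.t b) * σ (st.t a)
  t_bij : Function.Bijective (fun b => σ (st.t b))
  prod_s : ∀ X Y : L, σ (X * Y) = σ (X * st.s (σ Y))
  prod_t : ∀ X Y : L,
    σ (X * Y) = σ (X * st.t (Function.invFun (fun b => σ (st.t b)) (σ Y)))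

/-- Convolution of right bisections:  `(σ • η)(X) := σ(t(η(X₍₂₎)) X₍₁₎)`. -/
def rconv (σ η : L →ₗ[k] B) : L →ₗ[k] B :=
  (st.lift2 (fun x1 x2 => σ (st.t (η x2) * x1))).comp cop

/-- An automorphism `(Φ, φ)` of a left bialgebroid. -/
structure IsBgdAut (Φ : L →ₐ[k] L) (φ : B →ₐ[k] B) : Prop where
  bijL : Function.Bijective Φ
  bijB : Function.Bijective φ
  comp_s : ∀ b : B, Φ (st.s b) = st.s (φ b)
  comp_t : ∀ b : B, Φ (st.t b) = st.t (φ b)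
  comp_comul : ∀ X : L,
    cop (Φ X) = st.lift2 (fun x1 x2 => st.mk2 (Φ x1) (Φ x2)) (cop X)
  comp_counit : ∀ X : L, cou (Φ X) = φ (cou X)

/-- `Ad^L_σ(X) := s(σ(X₍₁₎)) X₍₂₎₊ t(σ(X₍₂₎₋))`, for a left Hopf algebroid. -/
def adL (σ : L →ₗ[k] B) (X : L) : L :=
  st.lift2 (fun x1 x2 => st.s (σ x1) *
    st.liftOp (fun p m => p * st.t (σ m)) (st.plusMinus cop x2)) (cop X)

/-- `Ad^R_σ(X) := t(σ(X₍₂₎)) X₍₁₎₍₊₎ s(σ(X₍₁₎₍₋₎))`, for an anti-left Hopf algebroid. -/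
def adR (σ : L →ₗ[k] B) (X : L) : L :=
  st.lift2 (fun x1 x2 => st.t (σ x2) *
    st.liftA (fun m p => p * st.s (σ m)) (st.minusPlus cop x1)) (cop X)

/-- The `B`-bimodule-map conditions on a map `L → B` used for `C¹(L,B)`. -/
def IsBimodMap (U : L →ₗ[k] B) : Prop :=
  (∀ (b : B) (X : L), U (st.t b * X) = U X * b) ∧
  (∀ (b : B) (X : L), U (st.s b * X) = b * U X)

/-- Convolution `(U * V)(X) = U(X₍₁₎) V(X₍₂₎)` of `B`-valued maps. -/
def cconv (U V : L →ₗ[k] B) : L →ₗ[k] B :=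
  (st.lift2 (fun x1 x2 => U x1 * V x2)).comp cop

/-- Extended vertical bisections `C¹(L,B)`: unital convolution-invertible `B`-bimodule maps
`U : L → B` with `U(X s(b)) = U(X t(b))`. -/
def IsC1 (U : L →ₗ[k] B) : Prop :=
  U 1 = 1 ∧ st.IsBimodMap U ∧
  (∀ (b : B) (X : L), U (X * st.s b) = U (X * st.t b)) ∧
  ∃ V : L →ₗ[k] B, st.IsBimodMap V ∧ st.cconv cop U V = cou ∧ st.cconv cop V U = cou

/-- Convolution product on `B`-bimodule maps `L ⊗_{B^e} L → B`:
`(f ⋆ g)(X,Y) = f(X₍₁₎,Y₍₁₎) g(X₍₂₎,Y₍₂₎)`. -/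
def conv2 (f g : L → L → B) (X Y : L) : B :=
  st.lift2 (fun y1 y2 =>
    st.lift2 (fun x1 x2 => f x1 y1 * g x2 y2) (cop X)) (cop Y)

/-- The unit `ε̃(X ⊗ Y) = ε(XY)` of the convolution algebra. -/
def unit2 (X Y : L) : B := cou (X * Y)

/-- Left-hand side of the 2-cocycle condition: `Γ(X, s(Γ(Y₍₁₎,Z₍₁₎)) Y₍₂₎Z₍₂₎)`. -/
def cocL (Γ : L → L → B) (X Y Z : L) : B :=
  st.lift2 (fun z1 z2 =>
    st.lift2 (fun y1 y2 => Γ X (st.s (Γ y1 z1) * (y2 * z2))) (cop Y)) (cop Z)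

/-- Right-hand side of the 2-cocycle condition: `Γ(s(Γ(X₍₁₎,Y₍₁₎)) X₍₂₎Y₍₂₎, Z)`. -/
def cocR (Γ : L → L → B) (X Y Z : L) : B :=
  st.lift2 (fun y1 y2 =>
    st.lift2 (fun x1 x2 => Γ (st.s (Γ x1 y1) * (x2 * y2)) Z) (cop X)) (cop Y)

/-- Membership of a bilinear map in `_B Hom_B (L ⊗_{B^e} L, B)`. -/
def IsBihom (Γ : L → L → B) : Prop :=
  (∃ Γ' : L →ₗ[k] L →ₗ[k] B, ∀ X Y, Γ' X Y = Γ X Y) ∧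
  (∀ (b c : B) (X Y : L), Γ (st.s b * (st.t c * X)) Y = b * Γ X Y * c) ∧
  (∀ (b c : B) (X Y : L), Γ (X * st.s b * st.t c) Y = Γ X (st.s b * (st.t c * Y)))

/-- An invertible normalised 2-cocycle on a left bialgebroid (Definition 2.6);
the collection of these is `Z²(L,B)`. -/
structure IsZ2 (Γ : L → L → B) : Prop where
  bihom : st.IsBihom Γ
  norm_left : ∀ X : L, Γ 1 X = cou X
  norm_right : ∀ X : L, Γ X 1 = cou X
  st_indep : ∀ (b : B) (X Y : L), Γ X (Y * st.s b) = Γ X (Y * st.t b)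
  cocycle : ∀ X Y Z : L, st.cocL cop Γ X Y Z = st.cocR cop Γ X Y Z
  inv : ∃ Γi : L → L → B, st.IsBihom Γi ∧
    (∀ X Y, st.conv2 cop Γ Γi X Y = unit2 cou X Y) ∧
    (∀ X Y, st.conv2 cop Γi Γ X Y = unit2 cou X Y)

/-- The coboundary `∂U(X,Y) = U⁻¹(X₍₁₎ t(U⁻¹(Y₍₁₎))) U(X₍₂₎Y₍₂₎)` of `U ∈ C¹(L,B)`. -/
def coboundary (U Ui : L →ₗ[k] B) (X Y : L) : B :=
  st.lift2 (fun y1 y2 =>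
    st.lift2 (fun x1 x2 => Ui (x1 * st.t (Ui y1)) * U (x2 * y2)) (cop X)) (cop Y)

/-- The transform `Γ^U(X,Y) = U⁻¹(X₍₁₎ t(U⁻¹(Y₍₁₎))) Γ(X₍₂₎,Y₍₂₎) U(X₍₃₎Y₍₃₎)`. -/
def gammaU (Γ : L → L → B) (U Ui : L →ₗ[k] B) (X Y : L) : B :=
  st.lift2 (fun y1 y23 => st.lift2 (fun y2 y3 =>
    st.lift2 (fun x1 x23 => st.lift2 (fun x2 x3 =>
      Ui (x1 * st.t (Ui y1)) * Γ x2 y2 * U (x3 * y3)) (cop x23)) (cop X))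
    (cop y23)) (cop Y)

/-- The cotwisted product `X ·_Γ Y := s(Γ(X₍₁₎,Y₍₁₎)) t(Γ⁻¹(X₍₃₎,Y₍₃₎)) X₍₂₎Y₍₂₎`. -/
def prodG (Γ Γi : L → L → B) (X Y : L) : L :=
  st.lift2 (fun y1 y23 => st.lift2 (fun y2 y3 =>
    st.lift2 (fun x1 x23 => st.lift2 (fun x2 x3 =>
      st.s (Γ x1 y1) * (st.t (Γi x3 y3) * (x2 * y2))) (cop x23)) (cop X))
    (cop y23)) (cop Y)

/-- `Ad_U(X) := s(U(X₍₁₎)) t(U⁻¹(X₍₃₎)) X₍₂₎`. -/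
def adU (U Ui : L →ₗ[k] B) (X : L) : L :=
  st.lift2 (fun x1 x23 => st.lift2 (fun x2 x3 =>
    st.s (U x1) * (st.t (Ui x3) * x2)) (cop x23)) (cop X)

end BgdST

end

namespace BgdST

variable {k : Type*} [Field k] {B L : Type*} [Ring B] [Algebra k B] [Ring L] [Algebra k L]

section Sweedler

variable (st : BgdST k B L)
variable {Q Q' : Type*} [AddCommGroup Q] [Module k Q] [AddCommGroup Q'] [Module k Q']

/-- Bilinear maps `L × L → Q` factoring through `L ⊗_B L`. -/
structure Bal (f : L → L → Q) : Prop where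
  add_left : ∀ x x' y, f (x + x') y = f x y + f x' y
  smul_left : ∀ (c : k) x y, f (c • x) y = c • f x y
  add_right : ∀ x y y', f x (y + y') = f x y + f x y'
  smul_right : ∀ (c : k) x y, f x (c • y) = c • f x y
  bal : ∀ a x y, f (st.t a * x) y = f x (st.s a * y)

/-- The linear map on `L ⊗_k L` given by a balanced bilinear map. -/
def Bal.toLin {st : BgdST k B L} {f : L → L → Q} (hf : st.Bal f) : L ⊗[k] L →ₗ[k] Q :=
  TensorProduct.lift
    (LinearMap.mk₂ k f hf.add_left hf.smul_left hf.add_right hf.smul_right)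

theorem Bal.rel_le_ker {st : BgdST k B L} {f : L → L → Q} (hf : st.Bal f) :
    st.rel ≤ LinearMap.ker hf.toLin := by
  refine Submodule.span_le.2 ?_
  rintro _ ⟨a, X, Y, rfl⟩
  simp [Bal.toLin, hf.bal]

theorem Bal.lift2_mk {st : BgdST k B L} {f : L → L → Q} (hf : st.Bal f) (z : L ⊗[k] L) :
    st.lift2 f (Submodule.Quotient.mk z) = hf.toLin z := by
  have h : ∃ F : st.T2 →ₗ[k] Q, ∀ x y, F (Submodule.Quotient.mk (x ⊗ₜ[k] y)) = f x y :=
    ⟨st.rel.liftQ hf.toLin hf.rel_le_ker, fun x y => by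
      rw [← Submodule.mkQ_apply, ← LinearMap.comp_apply, Submodule.liftQ_mkQ]
      simp [Bal.toLin]⟩
  have h' : st.lift2 f = h.choose := by
    unfold lift2 qtlift
    exact dif_pos h
  rw [h']
  have := h.choose_spec
  induction z with
  | zero => simp
  | tmul x y => simpa [Bal.toLin] using this x y
  | add z w hz hw => rw [Submodule.Quotient.mk_add, map_add, map_add, hz, hw]

theorem exists_finset_mk2 (z : st.T2) :
    ∃ S : Finset (L × L), z = ∑ p ∈ S, st.mk2 p.1 p.2 := by
  obtain ⟨w, rfl⟩ := Submodule.Quotient.mk_surjective _ z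
  obtain ⟨S, rfl⟩ := TensorProduct.exists_finset w
  exact ⟨S, by simp only [mk2, ← Submodule.mkQ_apply, map_sum]⟩

/-- Sweedler sum: the sum of `f z₍₁₎ z₍₂₎` over a chosen representative of `z`. -/
noncomputable def sw (z : st.T2) (f : L → L → Q) : Q :=
  ∑ p ∈ (st.exists_finset_mk2 z).choose, f p.1 p.2

theorem lift2_eq_sw {f : L → L → Q} (hf : st.Bal f) (z : st.T2) :
    st.lift2 f z = st.sw z f := by
  conv_lhs => rw [(st.exists_finset_mk2 z).choose_spec]
  rw [map_sum, sw]
  refine Finset.sum_congr rfl fun p _ => ?_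
  rw [mk2, hf.lift2_mk]
  simp [Bal.toLin]

theorem sw_mk {f : L → L → Q} (hf : st.Bal f) (z : L ⊗[k] L) :
    st.sw (Submodule.Quotient.mk z) f = hf.toLin z := by
  rw [← st.lift2_eq_sw hf, hf.lift2_mk]

theorem sw_mk2 {f : L → L → Q} (hf : st.Bal f) (x y : L) : st.sw (st.mk2 x y) f = f x y := by
  rw [mk2, st.sw_mk hf]
  simp [Bal.toLin]

theorem sw_add_arg {f : L → L → Q} (hf : st.Bal f) (z w : st.T2) :
    st.sw (z + w) f = st.sw z f + st.sw w f := by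
  simp only [← st.lift2_eq_sw hf, map_add]

theorem sw_smul_arg {f : L → L → Q} (hf : st.Bal f) (c : k) (z : st.T2) :
    st.sw (c • z) f = c • st.sw z f := by
  simp only [← st.lift2_eq_sw hf, map_smul]

omit [Module k Q] in
theorem sw_add (z : st.T2) (f g : L → L → Q) :
    st.sw z (fun x y => f x y + g x y) = st.sw z f + st.sw z g :=
  Finset.sum_add_distrib

theorem sw_smul (z : st.T2) (c : k) (f : L → L → Q) :
    st.sw z (fun x y => c • f x y) = c • st.sw z f :=
  Finset.smul_sum.symm

theorem map_sw (g : Q →ₗ[k] Q') (z : st.T2) (f : L → L → Q) :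
    g (st.sw z f) = st.sw z (fun x y => g (f x y)) :=
  map_sum g _ _

theorem mul_sw {A : Type*} [Ring A] [Algebra k A] (c : A) (z : st.T2) (f : L → L → A) :
    c * st.sw z f = st.sw z (fun x y => c * f x y) :=
  Finset.mul_sum _ _ _

theorem sw_mul {A : Type*} [Ring A] [Algebra k A] (c : A) (z : st.T2) (f : L → L → A) :
    st.sw z f * c = st.sw z (fun x y => f x y * c) :=
  Finset.sum_mul _ _ _

omit [Module k Q] in
theorem sw_comm (z w : st.T2) (f : L → L → L → L → Q) :
    st.sw z (fun x y => st.sw w (fun u v => f x y u v)) =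
      st.sw w (fun u v => st.sw z (fun x y => f x y u v)) :=
  Finset.sum_comm

theorem sw_sw {f : L → L → Q} (hf : st.Bal f) (z : st.T2) (g : L → L → st.T2) :
    st.sw (st.sw z g) f = st.sw z (fun x y => st.sw (g x y) f) := by
  simp only [← st.lift2_eq_sw hf, map_sw]

theorem Bal.sw_left {st : BgdST k B L} {f : L → L → Q} (hf : st.Bal f) (z : st.T2)
    (g : L → L → L) (y : L) :
    f (st.sw z g) y = st.sw z (fun a b => f (g a b) y) :=
  st.map_sw ((LinearMap.mk₂ k f hf.add_left hf.smul_left hf.add_right hf.smul_right).flip y) z g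

theorem mk2_bal : st.Bal st.mk2 where
  add_left x x' y := by simp [mk2, TensorProduct.add_tmul]
  smul_left c x y := by
    rw [mk2, mk2, ← TensorProduct.smul_tmul', Submodule.Quotient.mk_smul]
  add_right x y y' := by simp [mk2, TensorProduct.tmul_add]
  smul_right c x y := by simp [mk2]
  bal a x y := (Submodule.Quotient.eq _).2 (Submodule.subset_span ⟨a, x, y, rfl⟩)

/-- Trilinear maps `L × L × L → Q` factoring through `L ⊗_B L ⊗_B L`. -/
structure Tri (f : L → L → L → Q) : Prop where
  left : ∀ z, st.Bal (fun x y => f x y z)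
  right : ∀ x, st.Bal (f x)

/-- The linear map on `L ⊗_k L ⊗_k L` given by a balanced trilinear map. -/
def Tri.toLin {st : BgdST k B L} {f : L → L → L → Q} (hf : st.Tri f) :
    L ⊗[k] (L ⊗[k] L) →ₗ[k] Q :=
  TensorProduct.lift
    { toFun := fun x => (hf.right x).toLin
      map_add' := fun x x' => TensorProduct.ext' fun y z => by
        simp [Bal.toLin, (hf.left z).add_left]
      map_smul' := fun c x => TensorProduct.ext' fun y z => by
        simp [Bal.toLin, (hf.left z).smul_left] }

theorem Tri.rel3_le_ker {st : BgdST k B L} {f : L → L → L → Q} (hf : st.Tri f) :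
    st.rel3 ≤ LinearMap.ker hf.toLin := by
  refine Submodule.span_le.2 ?_
  rintro _ (⟨a, X, Y, Z, rfl⟩ | ⟨a, X, Y, Z, rfl⟩)
  · simp [Tri.toLin, Bal.toLin, (hf.left Z).bal]
  · simp [Tri.toLin, Bal.toLin, (hf.right X).bal]

/-- The linear map on `L ⊗_B L ⊗_B L` given by a balanced trilinear map. -/
noncomputable def Tri.lift3 {st : BgdST k B L} {f : L → L → L → Q} (hf : st.Tri f) : st.T3 →ₗ[k] Q :=
  st.rel3.liftQ hf.toLin hf.rel3_le_ker

theorem Tri.lift3_mk3 {st : BgdST k B L} {f : L → L → L → Q} (hf : st.Tri f) (x y z : L) :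
    hf.lift3 (st.mk3 x y z) = f x y z := by
  unfold Tri.lift3 mk3
  rw [← Submodule.mkQ_apply, ← LinearMap.comp_apply, Submodule.liftQ_mkQ]
  simp [Tri.toLin, Bal.toLin]

theorem mk3_tri : st.Tri st.mk3 where
  left z :=
    { add_left := fun x x' y => by simp [mk3, TensorProduct.add_tmul]
      smul_left := fun c x y => by
        rw [mk3, mk3, ← TensorProduct.smul_tmul', Submodule.Quotient.mk_smul]
      add_right := fun x y y' => by simp [mk3, TensorProduct.add_tmul, TensorProduct.tmul_add]
      smul_right := fun c x y => by
        simp only [mk3, ← TensorProduct.smul_tmul', TensorProduct.tmul_smul,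
          Submodule.Quotient.mk_smul]
      bal := fun a x y =>
        (Submodule.Quotient.eq _).2 (Submodule.subset_span (Or.inl ⟨a, x, y, z, rfl⟩)) }
  right x :=
    { add_left := fun y y' z => by simp [mk3, TensorProduct.add_tmul, TensorProduct.tmul_add]
      smul_left := fun c y z => by
        simp only [mk3, ← TensorProduct.smul_tmul', TensorProduct.tmul_smul,
          Submodule.Quotient.mk_smul]
      add_right := fun y z z' => by simp [mk3, TensorProduct.tmul_add]
      smul_right := fun c y z => by simp [mk3]
      bal := fun a y z =>
        (Submodule.Quotient.eq _).2 (Submodule.subset_span (Or.inr ⟨a, x, y, z, rfl⟩)) }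

end Sweedler

section Bialgebroid

variable {st : BgdST k B L} {cop : L →ₗ[k] st.T2} {cou : L →ₗ[k] B}
variable {Q : Type*} [AddCommGroup Q] [Module k Q]

/-- Left multiplication by `s b` on the first leg keeps a map balanced. -/
theorem Bal.s_mul {f : L → L → Q} (hf : st.Bal f) (b : B) :
    st.Bal (fun x y => f (st.s b * x) y) where
  add_left x x' y := by simp [mul_add, hf.add_left]
  smul_left c x y := by simp [hf.smul_left]
  add_right x y y' := by simp [hf.add_right]
  smul_right c x y := by simp [hf.smul_right]
  bal a x y := by rw [← mul_assoc, st.st_comm, mul_assoc, hf.bal]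

theorem Bal.t_mul {f : L → L → Q} (hf : st.Bal f) (b : B) :
    st.Bal (fun x y => f x (st.t b * y)) where
  add_left x x' y := by simp [hf.add_left]
  smul_left c x y := by simp [hf.smul_left]
  add_right x y y' := by simp [mul_add, hf.add_right]
  smul_right c x y := by simp [hf.smul_right]
  bal a x y := by rw [← mul_assoc, ← st.st_comm, mul_assoc, hf.bal]

theorem Bal.mul_right {f : L → L → Q} (hf : st.Bal f) (u v : L) :
    st.Bal (fun x y => f (x * u) (y * v)) where
  add_left x x' y := by simp [add_mul, hf.add_left]
  smul_left c x y := by simp [hf.smul_left]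
  add_right x y y' := by simp [add_mul, hf.add_right]
  smul_right c x y := by simp [hf.smul_right]
  bal a x y := by simp only [mul_assoc, hf.bal]

variable (h : st.IsLeftBialgebroid cop cou)
include h

theorem sw_cop_s {f : L → L → Q} (hf : st.Bal f) (b : B) (X : L) :
    st.sw (cop (st.s b * X)) f = st.sw (cop X) (fun x y => f (st.s b * x) y) := by
  rw [h.comul_s, st.lift2_eq_sw (st.mk2_bal.s_mul b), st.sw_sw hf]
  simp only [st.sw_mk2 hf]

theorem sw_cop_t {f : L → L → Q} (hf : st.Bal f) (b : B) (X : L) :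
    st.sw (cop (st.t b * X)) f = st.sw (cop X) (fun x y => f x (st.t b * y)) := by
  rw [h.comul_t, st.lift2_eq_sw (st.mk2_bal.t_mul b), st.sw_sw hf]
  simp only [st.sw_mk2 hf]

theorem sw_cop_one {f : L → L → Q} (hf : st.Bal f) : st.sw (cop 1) f = f 1 1 := by
  rw [h.comul_one, st.sw_mk2 hf]

theorem sw_takeuchi {f : L → L → Q} (hf : st.Bal f) (b : B) (X : L) :
    st.sw (cop X) (fun x y => f (x * st.t b) y) =
      st.sw (cop X) (fun x y => f x (y * st.s b)) := by
  have h1 := st.mk2_bal.mul_right (st.t b) 1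
  have h2 := st.mk2_bal.mul_right 1 (st.s b)
  simp only [mul_one] at h1 h2
  have := congrArg (fun z => st.sw z f) (h.takeuchi b X)
  simpa only [st.lift2_eq_sw h1, st.lift2_eq_sw h2, st.sw_sw hf, st.sw_mk2 hf] using this

theorem Tri.bal_right {f : L → L → L → Q} (hf : st.Tri f) :
    st.Bal (fun x w => st.sw (cop w) (fun y z => f x y z)) where
  add_left x x' w := by simp only [(hf.left _).add_left, sw_add]
  smul_left c x w := by simp only [(hf.left _).smul_left, sw_smul]
  add_right x w w' := by rw [map_add, st.sw_add_arg (hf.right x)]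
  smul_right c x w := by rw [map_smul, st.sw_smul_arg (hf.right x)]
  bal a x w := by
    rw [sw_cop_s h (hf.right x)]
    simp only [(hf.left _).bal]

theorem Tri.bal_left {f : L → L → L → Q} (hf : st.Tri f) :
    st.Bal (fun w z => st.sw (cop w) (fun x y => f x y z)) where
  add_left w w' z := by rw [map_add, st.sw_add_arg (hf.left z)]
  smul_left c w z := by rw [map_smul, st.sw_smul_arg (hf.left z)]
  add_right w z z' := by simp only [(hf.right _).add_right, sw_add]
  smul_right c w z := by simp only [(hf.right _).smul_right, sw_smul]
  bal a w z := by
    rw [sw_cop_t h (hf.left z)]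
    simp only [(hf.right _).bal]

theorem sw_coassoc {f : L → L → L → Q} (hf : st.Tri f) (X : L) :
    st.sw (cop X) (fun x w => st.sw (cop w) (fun y z => f x y z)) =
      st.sw (cop X) (fun w z => st.sw (cop w) (fun x y => f x y z)) := by
  have h3 := st.mk3_tri
  have hc := h.coassoc X
  simp only [st.lift2_eq_sw (h3.right _), st.lift2_eq_sw (h3.left _)] at hc
  rw [st.lift2_eq_sw (h3.bal_right h), st.lift2_eq_sw (h3.bal_left h)] at hc
  simpa only [map_sw, hf.lift3_mk3] using congrArg hf.lift3 hc

/-- Expressions `F(X₍₁₎, X₍₂₎, Y₍₁₎, Y₍₂₎)` that are well defined because `Δ(X)` lies in the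
Takeuchi product. -/
structure Bal2 (st : BgdST k B L) (F : L → L → L → L → Q) : Prop where
  bal : ∀ y y', st.Bal (fun x x' => F x x' y y')
  add_left : ∀ x x' u v y', F x x' (u + v) y' = F x x' u y' + F x x' v y'
  smul_left : ∀ x x' (c : k) u y', F x x' (c • u) y' = c • F x x' u y'
  add_right : ∀ x x' y u v, F x x' y (u + v) = F x x' y u + F x x' y v
  smul_right : ∀ x x' (c : k) y u, F x x' y (c • u) = c • F x x' y u
  mid_left : ∀ a x x' y y', F x x' (st.t a * y) y' = F (x * st.t a) x' y y'
  mid_right : ∀ a x x' y y', F x x' y (st.s a * y') = F x (x' * st.s a) y y'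

theorem Bal2.sw_bal {F : L → L → L → L → Q} (hF : st.Bal2 F) (X : L) :
    st.Bal (fun y y' => st.sw (cop X) (fun x x' => F x x' y y')) where
  add_left u v y' := by simp only [hF.add_left, sw_add]
  smul_left c u y' := by simp only [hF.smul_left, sw_smul]
  add_right y u v := by simp only [hF.add_right, sw_add]
  smul_right c y u := by simp only [hF.smul_right, sw_smul]
  bal a y y' := by
    simp only [hF.mid_left, hF.mid_right]
    exact sw_takeuchi h (hF.bal y y') a X

theorem Bal2.lift2 {F : L → L → L → L → Q} (hF : st.Bal2 F) (X Y : L) :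
    st.lift2 (fun y y' => st.lift2 (fun x x' => F x x' y y') (cop X)) (cop Y) =
      st.sw (cop Y) (fun y y' => st.sw (cop X) (fun x x' => F x x' y y')) := by
  simp only [st.lift2_eq_sw (hF.bal _ _)]
  exact st.lift2_eq_sw (hF.sw_bal h X) _

omit h in
theorem Bal.bal2_mul {f : L → L → Q} (hf : st.Bal f) :
    st.Bal2 (fun x x' y y' => f (x * y) (x' * y')) where
  bal y y' := hf.mul_right y y'
  add_left := by simp [mul_add, hf.add_left]
  smul_left := by simp [hf.smul_left]
  add_right := by simp [mul_add, hf.add_right]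
  smul_right := by simp [hf.smul_right]
  mid_left := by simp [mul_assoc]
  mid_right := by simp [mul_assoc]

theorem sw_cop_mul {f : L → L → Q} (hf : st.Bal f) (X Y : L) :
    st.sw (cop (X * Y)) f =
      st.sw (cop Y) (fun y y' => st.sw (cop X) (fun x x' => f (x * y) (x' * y'))) := by
  have hb := st.mk2_bal.bal2_mul.sw_bal h X
  have key : ∀ zr wr : L ⊗[k] L, Submodule.Quotient.mk zr = cop X →
      (Submodule.Quotient.mk (zr * wr) : st.T2) =
        st.sw (Submodule.Quotient.mk wr)
          (fun y y' => st.sw (cop X) (fun x x' => st.mk2 (x * y) (x' * y'))) := by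
    intro zr wr hz
    rw [st.sw_mk hb]
    induction wr with
    | zero => simp
    | add w w' hw hw' => rw [mul_add, Submodule.Quotient.mk_add, map_add, hw, hw']
    | tmul y y' =>
      simp only [Bal.toLin, TensorProduct.lift.tmul, LinearMap.mk₂_apply]
      rw [← hz, st.sw_mk (st.mk2_bal.mul_right y y')]
      clear hz
      induction zr with
      | zero => simp
      | add z z' hz hz' => rw [add_mul, Submodule.Quotient.mk_add, map_add, hz, hz']
      | tmul x x' => simp [Bal.toLin, mk2]
  have hm : cop (X * Y) =
      st.sw (cop Y) (fun y y' => st.sw (cop X) (fun x x' => st.mk2 (x * y) (x' * y'))) := by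
    rw [h.comul_mul]
    have hex : ∃ u : st.T2, ∀ zr wr : L ⊗[k] L, Submodule.Quotient.mk zr = cop X →
        Submodule.Quotient.mk wr = cop Y → Submodule.Quotient.mk (zr * wr) = u :=
      ⟨_, fun zr wr hz hw => by rw [key zr wr hz, hw]⟩
    have hmul : st.mulT2 (cop X) (cop Y) = hex.choose := by
      unfold mulT2
      exact dif_pos hex
    obtain ⟨zr, hz⟩ := Submodule.Quotient.mk_surjective _ (cop X)
    obtain ⟨wr, hw⟩ := Submodule.Quotient.mk_surjective _ (cop Y)
    rw [hmul, ← hex.choose_spec zr wr hz hw, key zr wr hz, hw]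
  rw [hm, st.sw_sw hf]
  simp only [st.sw_sw hf, st.sw_mk2 hf]

theorem sw_cop_mul_s {f : L → L → Q} (hf : st.Bal f) (b : B) (X : L) :
    st.sw (cop (X * st.s b)) f = st.sw (cop X) (fun x y => f (x * st.s b) y) := by
  have hb := hf.bal2_mul.sw_bal h X
  rw [sw_cop_mul h hf, ← mul_one (st.s b), sw_cop_s h hb, sw_cop_one h (hb.s_mul b)]
  simp only [mul_one]

theorem sw_cop_mul_t {f : L → L → Q} (hf : st.Bal f) (b : B) (X : L) :
    st.sw (cop (X * st.t b)) f = st.sw (cop X) (fun x y => f x (y * st.t b)) := by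
  have hb := hf.bal2_mul.sw_bal h X
  rw [sw_cop_mul h hf, ← mul_one (st.t b), sw_cop_t h hb, sw_cop_one h (hb.t_mul b)]
  simp only [mul_one]

/-- Expressions in `X₍₁₎, X₍₂₎, X₍₃₎, Y₍₁₎, Y₍₂₎, Y₍₃₎` that are well defined because `Δ(X)` lies
in the Takeuchi product. -/
structure Bal3 (st : BgdST k B L) (F : L → L → L → L → L → L → Q) : Prop where
  left : ∀ x₃ y₃, st.Bal2 (fun x₁ x₂ y₁ y₂ => F x₁ x₂ x₃ y₁ y₂ y₃)
  right : ∀ x₁ y₁, st.Bal2 (fun x₂ x₃ y₂ y₃ => F x₁ x₂ x₃ y₁ y₂ y₃)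

omit h in
theorem Bal3.tri {F : L → L → L → L → L → L → Q} (hF : st.Bal3 F) (y₁ y₂ y₃ : L) :
    st.Tri (fun x₁ x₂ x₃ => F x₁ x₂ x₃ y₁ y₂ y₃) where
  left x₃ := (hF.left x₃ y₃).bal y₁ y₂
  right x₁ := (hF.right x₁ y₁).bal y₂ y₃

theorem Bal3.sw_tri {F : L → L → L → L → L → L → Q} (hF : st.Bal3 F) (X : L) :
    st.Tri (fun y₁ y₂ y₃ => st.sw (cop X) (fun x₁ w => st.sw (cop w) (fun x₂ x₃ =>
      F x₁ x₂ x₃ y₁ y₂ y₃))) where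
  left y₃ :=
    { add_left := fun x x' y => by
        simp only [(hF.left _ _).add_left, sw_add]
      smul_left := fun c x y => by simp only [(hF.left _ _).smul_left, sw_smul]
      add_right := fun x y y' => by simp only [(hF.left _ _).add_right, sw_add]
      smul_right := fun c x y => by simp only [(hF.left _ _).smul_right, sw_smul]
      bal := fun a y y' => by
        simp only [sw_coassoc h (hF.tri _ _ _)]
        simp only [((hF.left _ _).sw_bal h _).bal] }
  right y₁ :=
    { add_left := fun x x' y => by simp only [(hF.right _ _).add_left, sw_add]
      smul_left := fun c x y => by simp only [(hF.right _ _).smul_left, sw_smul]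
      add_right := fun x y y' => by simp only [(hF.right _ _).add_right, sw_add]
      smul_right := fun c x y => by simp only [(hF.right _ _).smul_right, sw_smul]
      bal := fun a y y' => by simp only [((hF.right _ _).sw_bal h _).bal] }

/-- Simultaneous coassociativity in two variables. -/
theorem Bal3.coassoc {F : L → L → L → L → L → L → Q} (hF : st.Bal3 F) (X Y : L) :
    st.sw (cop Y) (fun y₁ v => st.sw (cop X) (fun x₁ w =>
      st.sw (cop v) (fun y₂ y₃ => st.sw (cop w) (fun x₂ x₃ => F x₁ x₂ x₃ y₁ y₂ y₃)))) =
    st.sw (cop Y) (fun v y₃ => st.sw (cop X) (fun w x₃ =>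
      st.sw (cop v) (fun y₁ y₂ => st.sw (cop w) (fun x₁ x₂ => F x₁ x₂ x₃ y₁ y₂ y₃)))) := by
  have hK := sw_coassoc h (hF.sw_tri h X) Y
  simp only [sw_comm st (cop X)]
  rw [hK]
  simp only [sw_coassoc h (hF.tri _ _ _)]

end Bialgebroid

end BgdST

namespace BgdST

variable {k : Type*} [Field k] {B L : Type*} [Ring B] [Algebra k B] [Ring L] [Algebra k L]

section Convolution

/-- Unbundled form of `IsBihom`. -/
structure Bih (st : BgdST k B L) (f : L → L → B) : Prop where
  add_left : ∀ x x' y, f (x + x') y = f x y + f x' y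
  smul_left : ∀ (c : k) x y, f (c • x) y = c • f x y
  add_right : ∀ x y y', f x (y + y') = f x y + f x y'
  smul_right : ∀ (c : k) x y, f x (c • y) = c • f x y
  s_left : ∀ b x y, f (st.s b * x) y = b * f x y
  t_left : ∀ b x y, f (st.t b * x) y = f x y * b
  s_mid : ∀ b x y, f (x * st.s b) y = f x (st.s b * y)
  t_mid : ∀ b x y, f (x * st.t b) y = f x (st.t b * y)

theorem isBihom_iff_bih {st : BgdST k B L} {f : L → L → B} : st.IsBihom f ↔ st.Bih f := by
  constructor
  · rintro ⟨⟨f', hf'⟩, h1, h2⟩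
    exact
      { add_left := by simp [← hf']
        smul_left := by simp [← hf']
        add_right := by simp [← hf']
        smul_right := by simp [← hf']
        s_left := fun b x y => by simpa [st.t_one] using h1 b 1 x y
        t_left := fun b x y => by simpa using h1 1 b x y
        s_mid := fun b x y => by simpa [st.t_one] using h2 b 1 x y
        t_mid := fun b x y => by simpa using h2 1 b x y }
  · intro h
    exact ⟨⟨LinearMap.mk₂ k f h.add_left h.smul_left h.add_right h.smul_right, fun _ _ => rfl⟩,
      fun b c X Y => by rw [h.s_left, h.t_left, mul_assoc],
      fun b c X Y => by rw [h.t_mid, h.s_mid]⟩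

variable {st : BgdST k B L} {cop : L →ₗ[k] st.T2} {cou : L →ₗ[k] B}

theorem Bih.bal2_mul {f g : L → L → B} (hf : st.Bih f) (hg : st.Bih g) :
    st.Bal2 (fun x x' y y' => f x y * g x' y') where
  bal y y' :=
    { add_left := by simp [hf.add_left, add_mul]
      smul_left := by simp [hf.smul_left]
      add_right := by simp [hg.add_left, mul_add]
      smul_right := by simp [hg.smul_left]
      bal := by simp [hf.t_left, hg.s_left, mul_assoc] }
  add_left := by simp [hf.add_right, add_mul]
  smul_left := by simp [hf.smul_right]
  add_right := by simp [hg.add_right, mul_add]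
  smul_right := by simp [hg.smul_right]
  mid_left := by simp [hf.t_mid]
  mid_right := by simp [hg.s_mid]

theorem Bih.bal3_mul {e f g : L → L → B} (he : st.Bih e) (hf : st.Bih f) (hg : st.Bih g) :
    st.Bal3 (fun x₁ x₂ x₃ y₁ y₂ y₃ => e x₁ y₁ * f x₂ y₂ * g x₃ y₃) where
  left x₃ y₃ :=
    { bal := fun y y' =>
        { add_left := by simp [he.add_left, add_mul]
          smul_left := by simp [he.smul_left]
          add_right := by simp [hf.add_left, mul_add, add_mul]
          smul_right := by simp [hf.smul_left]
          bal := by simp [he.t_left, hf.s_left, mul_assoc] }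
      add_left := by simp [he.add_right, add_mul]
      smul_left := by simp [he.smul_right]
      add_right := by simp [hf.add_right, mul_add, add_mul]
      smul_right := by simp [hf.smul_right]
      mid_left := by simp [he.t_mid]
      mid_right := by simp [hf.s_mid] }
  right x₁ y₁ :=
    { bal := fun y y' =>
        { add_left := by simp [hf.add_left, add_mul, mul_add]
          smul_left := by simp [hf.smul_left]
          add_right := by simp [hg.add_left, mul_add]
          smul_right := by simp [hg.smul_left]
          bal := by simp [hf.t_left, hg.s_left, mul_assoc] }
      add_left := by simp [hf.add_right, add_mul, mul_add]
      smul_left := by simp [hf.smul_right]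
      add_right := by simp [hg.add_right, mul_add]
      smul_right := by simp [hg.smul_right]
      mid_left := by simp [hf.t_mid]
      mid_right := by simp [hg.s_mid] }

variable (h : st.IsLeftBialgebroid cop cou)
include h

theorem conv2_eq_sw {f g : L → L → B} (hf : st.Bih f) (hg : st.Bih g) (X Y : L) :
    st.conv2 cop f g X Y =
      st.sw (cop Y) (fun y y' => st.sw (cop X) (fun x x' => f x y * g x' y')) :=
  (hf.bal2_mul hg).lift2 h X Y

theorem Bih.conv2 {f g : L → L → B} (hf : st.Bih f) (hg : st.Bih g) :
    st.Bih (st.conv2 cop f g) where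
  add_left X X' Y := by
    simp only [conv2_eq_sw h hf hg, map_add, st.sw_add_arg ((hf.bal2_mul hg).bal _ _), sw_add]
  smul_left c X Y := by
    simp only [conv2_eq_sw h hf hg, map_smul, st.sw_smul_arg ((hf.bal2_mul hg).bal _ _), sw_smul]
  add_right X Y Y' := by
    simp only [conv2_eq_sw h hf hg, map_add, st.sw_add_arg ((hf.bal2_mul hg).sw_bal h X)]
  smul_right c X Y := by
    simp only [conv2_eq_sw h hf hg, map_smul, st.sw_smul_arg ((hf.bal2_mul hg).sw_bal h X)]
  s_left b X Y := by
    simp only [conv2_eq_sw h hf hg, sw_cop_s h ((hf.bal2_mul hg).bal _ _), hf.s_left, mul_sw,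
      mul_assoc]
  t_left b X Y := by
    simp only [conv2_eq_sw h hf hg, sw_cop_t h ((hf.bal2_mul hg).bal _ _), hg.t_left, sw_mul,
      mul_assoc]
  s_mid b X Y := by
    simp only [conv2_eq_sw h hf hg, sw_cop_mul_s h ((hf.bal2_mul hg).bal _ _),
      sw_cop_s h ((hf.bal2_mul hg).sw_bal h X), hf.s_mid]
  t_mid b X Y := by
    simp only [conv2_eq_sw h hf hg, sw_cop_mul_t h ((hf.bal2_mul hg).bal _ _),
      sw_cop_t h ((hf.bal2_mul hg).sw_bal h X), hg.t_mid]

theorem conv2_assoc {e f g : L → L → B} (he : st.Bih e) (hf : st.Bih f) (hg : st.Bih g) :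
    st.conv2 cop (st.conv2 cop e f) g = st.conv2 cop e (st.conv2 cop f g) := by
  funext X Y
  rw [conv2_eq_sw h (he.conv2 h hf) hg, conv2_eq_sw h he (hf.conv2 h hg)]
  simp only [conv2_eq_sw h he hf, conv2_eq_sw h hf hg, mul_sw, sw_mul, ← mul_assoc]
  exact ((he.bal3_mul hf hg).coassoc h X Y).symm

/-- Convolution preserves the condition `f(X, Y s(b)) = f(X, Y t(b))`. -/
theorem conv2_st_indep {f g : L → L → B} (hf : st.Bih f) (hg : st.Bih g)
    (hf' : ∀ (b : B) (X Y : L), f X (Y * st.s b) = f X (Y * st.t b))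
    (hg' : ∀ (b : B) (X Y : L), g X (Y * st.s b) = g X (Y * st.t b)) (b : B) (X Y : L) :
    st.conv2 cop f g X (Y * st.s b) = st.conv2 cop f g X (Y * st.t b) := by
  have hb := (hf.bal2_mul hg).sw_bal h X
  rw [conv2_eq_sw h hf hg, conv2_eq_sw h hf hg, sw_cop_mul_s h hb, sw_cop_mul_t h hb]
  simp only [hf', ← hg']
  exact sw_takeuchi h hb b Y

end Convolution

section Action

variable {st : BgdST k B L} {cop : L →ₗ[k] st.T2} {cou : L →ₗ[k] B}

/-- The left translation `X ↦ s(V(X₍₁₎)) X₍₂₎`. -/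
noncomputable def act (st : BgdST k B L) (cop : L →ₗ[k] st.T2) (V : L →ₗ[k] B) (X : L) : L :=
  st.sw (cop X) (fun x y => st.s (V x) * y)

theorem IsBimodMap.bal {V W : L →ₗ[k] B} (hV : st.IsBimodMap V) (hW : st.IsBimodMap W) :
    st.Bal (fun x y => V x * W y) where
  add_left := by simp [add_mul]
  smul_left := by simp
  add_right := by simp [mul_add]
  smul_right := by simp
  bal := by simp [hV.1, hW.2, mul_assoc]

theorem IsBimodMap.act_bal {V : L →ₗ[k] B} (hV : st.IsBimodMap V) :
    st.Bal (fun x y => st.s (V x) * y) where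
  add_left := by simp [add_mul]
  smul_left := by simp
  add_right := by simp [mul_add]
  smul_right := by simp
  bal := by simp [hV.1, mul_assoc]

theorem IsBimodMap.tri {V : L →ₗ[k] B} (hV : st.IsBimodMap V) {Q : Type*} [AddCommGroup Q]
    [Module k Q] {f : L → L → Q} (hf : st.Bal f) :
    st.Tri (fun x y z => f (st.s (V x) * y) z) where
  left z :=
    { add_left := by simp [add_mul, hf.add_left]
      smul_left := by simp [hf.smul_left]
      add_right := by simp [mul_add, hf.add_left]
      smul_right := by simp [hf.smul_left]
      bal := by simp [hV.1, mul_assoc] }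
  right x := hf.s_mul (V x)

theorem cconv_apply {V W : L →ₗ[k] B} (hV : st.IsBimodMap V) (hW : st.IsBimodMap W) (X : L) :
    st.cconv cop V W X = st.sw (cop X) (fun x y => V x * W y) :=
  st.lift2_eq_sw (hV.bal hW) _

/-- A bimodule map evaluated on a translate is a convolution. -/
theorem map_act {V W : L →ₗ[k] B} (hV : st.IsBimodMap V) (hW : st.IsBimodMap W) (X : L) :
    W (st.act cop V X) = st.cconv cop V W X := by
  rw [cconv_apply hV hW, act, map_sw]
  simp only [hW.2]

variable (h : st.IsLeftBialgebroid cop cou)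
include h

theorem sw_cop_act {V : L →ₗ[k] B} (hV : st.IsBimodMap V) {Q : Type*} [AddCommGroup Q]
    [Module k Q] {f : L → L → Q} (hf : st.Bal f) (X : L) :
    st.sw (cop (st.act cop V X)) f = st.sw (cop X) (fun x y => f (st.act cop V x) y) := by
  rw [act, map_sw, st.sw_sw hf]
  simp only [sw_cop_s h hf, act, hf.sw_left]
  exact sw_coassoc h (hV.tri hf) X

theorem isBimodMap_counit : st.IsBimodMap cou := ⟨h.counit_t, h.counit_s⟩

theorem act_counit (X : L) : st.act cop cou X = X := by
  rw [act, ← st.lift2_eq_sw (isBimodMap_counit h).act_bal, h.counit_comul_left]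

theorem act_act {V W : L →ₗ[k] B} (hV : st.IsBimodMap V) (hW : st.IsBimodMap W)
    (hVW : st.cconv cop V W = cou) (X : L) : st.act cop W (st.act cop V X) = X := by
  conv_lhs => rw [act, sw_cop_act h hV hW.act_bal]
  simp only [map_act hV hW, hVW]
  exact act_counit h X

theorem act_one {V : L →ₗ[k] B} (hV : st.IsBimodMap V) (hV1 : V 1 = 1) :
    st.act cop V 1 = 1 := by
  rw [act, sw_cop_one h hV.act_bal, hV1, map_one, one_mul]

theorem act_mul_t {V : L →ₗ[k] B} (hV : st.IsBimodMap V) (b : B) (X : L) :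
    st.act cop V (X * st.t b) = st.act cop V X * st.t b := by
  rw [act, sw_cop_mul_t h hV.act_bal, act, sw_mul]
  simp only [mul_assoc]

end Action

section Bihoms

variable {st : BgdST k B L} {cop : L →ₗ[k] st.T2} {cou : L →ₗ[k] B}

/-- The map `(X, Y) ↦ V(XY)`. -/
theorem IsBimodMap.bih_mul {V : L →ₗ[k] B} (hV : st.IsBimodMap V) :
    st.Bih (fun X Y => V (X * Y)) where
  add_left := by simp [add_mul]
  smul_left := by simp
  add_right := by simp [mul_add]
  smul_right := by simp
  s_left := by simp [mul_assoc, hV.2]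
  t_left := by simp [mul_assoc, hV.1]
  s_mid := by simp [mul_assoc]
  t_mid := by simp [mul_assoc]

/-- The map `(X, Y) ↦ V(X t(V(Y)))`. -/
theorem IsBimodMap.bih_mul_t {V : L →ₗ[k] B} (hV : st.IsBimodMap V)
    (hst : ∀ (b : B) (X : L), V (X * st.s b) = V (X * st.t b)) :
    st.Bih (fun X Y => V (X * st.t (V Y))) where
  add_left := by simp [add_mul]
  smul_left := by simp
  add_right := by simp [mul_add]
  smul_right := by simp
  s_left := by simp [mul_assoc, hV.2]
  t_left := by simp [mul_assoc, hV.1]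
  s_mid b X Y := by rw [mul_assoc, st.st_comm, ← mul_assoc, hst, hV.2, st.t_mul, mul_assoc]
  t_mid b X Y := by rw [hV.1, st.t_mul, mul_assoc]

variable (h : st.IsLeftBialgebroid cop cou)
include h

theorem conv2_mul_t {V : L →ₗ[k] B} (hV : st.IsBimodMap V)
    (hst : ∀ (b : B) (X : L), V (X * st.s b) = V (X * st.t b)) {g : L → L → B}
    (hg : st.Bih g) (X Y : L) :
    st.conv2 cop (fun X Y => V (X * st.t (V Y))) g X Y =
      g (st.act cop V X) (st.act cop V Y) := by
  have hG : ∀ u v : L, st.Bal (fun x x' => V x * g (x' * u) v) := fun u v =>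
    { add_left := by simp [add_mul]
      smul_left := by simp
      add_right := by simp [add_mul, mul_add, hg.add_left]
      smul_right := by simp [hg.smul_left]
      bal := by simp [hV.1, mul_assoc, hg.s_left] }
  let G := LinearMap.mk₂ k g hg.add_left hg.smul_left hg.add_right hg.smul_right
  have h1 : ∀ z f y, g (st.sw z f) y = st.sw z (fun a b => g (f a b) y) :=
    fun z f y => st.map_sw (G.flip y) z f
  have h2 : ∀ z f x, g x (st.sw z f) = st.sw z (fun a b => g x (f a b)) :=
    fun z f x => st.map_sw (G x) z f
  rw [conv2_eq_sw h (hV.bih_mul_t hst) hg]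
  simp only [act, h1, h2, hg.s_left]
  conv_rhs => rw [sw_comm]
  refine congrArg _ (funext fun y => funext fun y' => ?_)
  have := sw_takeuchi h (hG 1 y') (V y) X
  simpa only [mul_one, hg.s_mid] using this

theorem conv2_mul_mul {V W : L →ₗ[k] B} (hV : st.IsBimodMap V) (hW : st.IsBimodMap W)
    (hVW : st.cconv cop V W = cou) :
    st.conv2 cop (fun X Y => V (X * Y)) (fun X Y => W (X * Y)) = unit2 cou := by
  funext X Y
  rw [conv2_eq_sw h hV.bih_mul hW.bih_mul, unit2, ← hVW, cconv_apply hV hW,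
    sw_cop_mul h (hV.bal hW)]

theorem conv2_mul_t_mul_t {V W : L →ₗ[k] B} (hV : st.IsBimodMap V) (hW : st.IsBimodMap W)
    (hVst : ∀ (b : B) (X : L), V (X * st.s b) = V (X * st.t b))
    (hWst : ∀ (b : B) (X : L), W (X * st.s b) = W (X * st.t b))
    (hVW : st.cconv cop V W = cou) :
    st.conv2 cop (fun X Y => V (X * st.t (V Y))) (fun X Y => W (X * st.t (W Y))) =
      unit2 cou := by
  funext X Y
  rw [conv2_mul_t h hV hVst (hW.bih_mul_t hWst), map_act hV hW, hVW, ← act_mul_t h hV,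
    map_act hV hW, hVW, h.counit_char_t, unit2]

theorem bih_unit2 : st.Bih (unit2 cou) := (isBimodMap_counit h).bih_mul

theorem counit_mul_s (b : B) (X : L) : cou (X * st.s b) = cou (X * st.t b) := by
  have hs := h.counit_char_s X (st.s b)
  have ht := h.counit_char_t X (st.s b)
  have hb : cou (st.s b) = b := by simpa [h.counit_one] using h.counit_s b 1
  rw [hb] at hs ht
  rw [ht]

theorem unit2_conv2 {f : L → L → B} (hf : st.Bih f) : st.conv2 cop (unit2 cou) f = f := by
  have hu : unit2 cou = fun X Y => cou (X * st.t (cou Y)) := by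
    funext X Y
    rw [unit2, h.counit_char_t]
  funext X Y
  rw [hu, conv2_mul_t h (isBimodMap_counit h) (counit_mul_s h) hf, act_counit h, act_counit h]

end Bihoms

end BgdST

namespace BgdST

variable {k : Type*} [Field k] {B L : Type*} [Ring B] [Algebra k B] [Ring L] [Algebra k L]

section Twist

variable {st : BgdST k B L} {cop : L →ₗ[k] st.T2} {cou : L →ₗ[k] B}

/-- The one-sided twisted product `s(Γ(X₍₁₎,Y₍₁₎)) X₍₂₎Y₍₂₎`. -/
noncomputable def twMul (st : BgdST k B L) (cop : L →ₗ[k] st.T2) (Γ : L → L → B) (X Y : L) : L :=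
  st.sw (cop Y) (fun y y' => st.sw (cop X) (fun x x' => st.s (Γ x y) * (x' * y')))

theorem Bih.bal2_twMul {Γ : L → L → B} (hΓ : st.Bih Γ) :
    st.Bal2 (fun x x' y y' => st.s (Γ x y) * (x' * y')) where
  bal y y' :=
    { add_left := by simp [hΓ.add_left, add_mul]
      smul_left := by simp [hΓ.smul_left]
      add_right := by simp [mul_add, add_mul]
      smul_right := by simp
      bal := by simp [hΓ.t_left, mul_assoc] }
  add_left := by simp [hΓ.add_right, add_mul]
  smul_left := by simp [hΓ.smul_right]
  add_right := by simp [mul_add]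
  smul_right := by simp
  mid_left := by simp [hΓ.t_mid]
  mid_right := by simp [mul_assoc]

theorem Bih.bal3_twMul {Γ : L → L → B} (hΓ : st.Bih Γ) {Q : Type*} [AddCommGroup Q] [Module k Q]
    {f : L → L → Q} (hf : st.Bal f) :
    st.Bal3 (fun x₁ x₂ x₃ y₁ y₂ y₃ => f (st.s (Γ x₁ y₁) * (x₂ * y₂)) (x₃ * y₃)) where
  left x₃ y₃ :=
    { bal := fun y y' =>
        { add_left := by simp [hΓ.add_left, add_mul, hf.add_left]
          smul_left := by simp [hΓ.smul_left, hf.smul_left]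
          add_right := by simp [mul_add, add_mul, hf.add_left]
          smul_right := by simp [hf.smul_left]
          bal := by simp [hΓ.t_left, mul_assoc] }
      add_left := by simp [hΓ.add_right, add_mul, hf.add_left]
      smul_left := by simp [hΓ.smul_right, hf.smul_left]
      add_right := by simp [mul_add, hf.add_left]
      smul_right := by simp [hf.smul_left]
      mid_left := by simp [hΓ.t_mid]
      mid_right := by simp [mul_assoc] }
  right x₁ y₁ := (hf.s_mul (Γ x₁ y₁)).bal2_mul

variable (h : st.IsLeftBialgebroid cop cou)
include h

theorem sw_cop_twMul {Γ : L → L → B} (hΓ : st.Bih Γ) {Q : Type*} [AddCommGroup Q] [Module k Q]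
    {f : L → L → Q} (hf : st.Bal f) (X Y : L) :
    st.sw (cop (st.twMul cop Γ X Y)) f =
      st.sw (cop Y) (fun y y' => st.sw (cop X) (fun x x' =>
        f (st.twMul cop Γ x y) (x' * y'))) := by
  rw [twMul]
  simp only [map_sw, st.sw_sw hf, sw_cop_s h hf, sw_cop_mul h (hf.s_mul _), twMul, hf.sw_left]
  exact (hΓ.bal3_twMul hf).coassoc h X Y

theorem cocL_eq {Γ : L → L → B} (hΓ : st.Bih Γ) (X Y Z : L) :
    st.cocL cop Γ X Y Z = Γ X (st.twMul cop Γ Y Z) := by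
  let G := LinearMap.mk₂ k Γ hΓ.add_left hΓ.smul_left hΓ.add_right hΓ.smul_right
  have hF : st.Bal2 (fun y y' z z' => Γ X (st.s (Γ y z) * (y' * z'))) := by
    have hP := hΓ.bal2_twMul
    exact
    { bal := fun y y' =>
        { add_left := fun a b c => by rw [(hP.bal y y').add_left, hΓ.add_right]
          smul_left := fun a b c => by rw [(hP.bal y y').smul_left, hΓ.smul_right]
          add_right := fun a b c => by rw [(hP.bal y y').add_right, hΓ.add_right]
          smul_right := fun a b c => by rw [(hP.bal y y').smul_right, hΓ.smul_right]
          bal := fun a b c => by rw [(hP.bal y y').bal] }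
      add_left := fun _ _ _ _ _ => by rw [hP.add_left, hΓ.add_right]
      smul_left := fun _ _ _ _ _ => by rw [hP.smul_left, hΓ.smul_right]
      add_right := fun _ _ _ _ _ => by rw [hP.add_right, hΓ.add_right]
      smul_right := fun _ _ _ _ _ => by rw [hP.smul_right, hΓ.smul_right]
      mid_left := fun _ _ _ _ _ => by rw [hP.mid_left]
      mid_right := fun _ _ _ _ _ => by rw [hP.mid_right] }
  have h1 : ∀ z f, Γ X (st.sw z f) = st.sw z (fun a b => Γ X (f a b)) :=
    fun z f => st.map_sw (G X) z f
  rw [cocL, hF.lift2 h]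
  simp only [twMul, h1]

theorem cocR_eq {Γ : L → L → B} (hΓ : st.Bih Γ) (X Y Z : L) :
    st.cocR cop Γ X Y Z = Γ (st.twMul cop Γ X Y) Z := by
  let G := LinearMap.mk₂ k Γ hΓ.add_left hΓ.smul_left hΓ.add_right hΓ.smul_right
  have hF : st.Bal2 (fun y y' z z' => Γ (st.s (Γ y z) * (y' * z')) Z) := by
    have hP := hΓ.bal2_twMul
    exact
    { bal := fun y y' =>
        { add_left := fun a b c => by rw [(hP.bal y y').add_left, hΓ.add_left]
          smul_left := fun a b c => by rw [(hP.bal y y').smul_left, hΓ.smul_left]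
          add_right := fun a b c => by rw [(hP.bal y y').add_right, hΓ.add_left]
          smul_right := fun a b c => by rw [(hP.bal y y').smul_right, hΓ.smul_left]
          bal := fun a b c => by rw [(hP.bal y y').bal] }
      add_left := fun _ _ _ _ _ => by rw [hP.add_left, hΓ.add_left]
      smul_left := fun _ _ _ _ _ => by rw [hP.smul_left, hΓ.smul_left]
      add_right := fun _ _ _ _ _ => by rw [hP.add_right, hΓ.add_left]
      smul_right := fun _ _ _ _ _ => by rw [hP.smul_right, hΓ.smul_left]
      mid_left := fun _ _ _ _ _ => by rw [hP.mid_left]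
      mid_right := fun _ _ _ _ _ => by rw [hP.mid_right] }
  have h1 : ∀ z f, Γ (st.sw z f) Z = st.sw z (fun a b => Γ (f a b) Z) :=
    fun z f => st.map_sw (G.flip Z) z f
  rw [cocR, hF.lift2 h]
  simp only [twMul, h1]

/-- A 2-cocycle makes the one-sided twisted product associative. -/
theorem twMul_assoc {Γ : L → L → B} (hΓ : st.Bih Γ)
    (hc : ∀ X Y Z : L, st.cocL cop Γ X Y Z = st.cocR cop Γ X Y Z) (X Y Z : L) :
    st.twMul cop Γ (st.twMul cop Γ X Y) Z = st.twMul cop Γ X (st.twMul cop Γ Y Z) := by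
  have hb := hΓ.bal2_twMul
  conv_rhs => rw [twMul, sw_cop_twMul h hΓ (hb.sw_bal h X)]
  conv_lhs => rw [twMul]
  simp only [sw_cop_twMul h hΓ (hb.bal _ _), ← cocL_eq h hΓ, ← cocR_eq h hΓ, hc, mul_assoc]

theorem one_twMul {Γ : L → L → B} (hΓ : st.Bih Γ) (h1 : ∀ X, Γ 1 X = cou X) (X : L) :
    st.twMul cop Γ 1 X = X := by
  simp only [twMul, sw_cop_one h (hΓ.bal2_twMul.bal _ _), h1, one_mul]
  exact act_counit h X

theorem twMul_one {Γ : L → L → B} (hΓ : st.Bih Γ) (h1 : ∀ X, Γ X 1 = cou X) (X : L) :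
    st.twMul cop Γ X 1 = X := by
  rw [twMul, sw_cop_one h (hΓ.bal2_twMul.sw_bal h X)]
  simp only [h1, mul_one]
  exact act_counit h X

theorem twMul_unit2 (X Y : L) : st.twMul cop (unit2 cou) X Y = X * Y := by
  conv_rhs => rw [← act_counit h (X * Y), act, sw_cop_mul h (isBimodMap_counit h).act_bal]
  rfl

theorem conv2_mul {Γ : L → L → B} (hΓ : st.Bih Γ) {U : L →ₗ[k] B} (hU : st.IsBimodMap U)
    (X Y : L) :
    st.conv2 cop Γ (fun X Y => U (X * Y)) X Y = U (st.twMul cop Γ X Y) := by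
  rw [conv2_eq_sw h hΓ hU.bih_mul, twMul]
  simp only [map_sw, hU.2]

theorem gammaU_eq_conv2 {Γ : L → L → B} (hΓ : st.Bih Γ) {U V : L →ₗ[k] B}
    (hU : st.IsBimodMap U) (hV : st.IsBimodMap V)
    (hVst : ∀ (b : B) (X : L), V (X * st.s b) = V (X * st.t b)) :
    st.gammaU cop Γ U V =
      st.conv2 cop (fun X Y => V (X * st.t (V Y)))
        (st.conv2 cop Γ (fun X Y => U (X * Y))) := by
  have hA := hV.bih_mul_t hVst
  have hM := hU.bih_mul
  have hF := hA.bal3_mul hΓ hM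
  funext X Y
  rw [conv2_eq_sw h hA (hΓ.conv2 h hM)]
  simp only [conv2_eq_sw h hΓ hM, mul_sw, ← mul_assoc]
  simp only [gammaU, fun x₁ y₁ y₂ y₃ => st.lift2_eq_sw ((hF.tri y₁ y₂ y₃).right x₁),
    fun y₁ y₂ y₃ => st.lift2_eq_sw ((hF.tri y₁ y₂ y₃).bal_right h),
    fun y₁ => st.lift2_eq_sw ((hF.sw_tri h X).right y₁)]
  rw [st.lift2_eq_sw ((hF.sw_tri h X).bal_right h)]
  refine congrArg _ (funext fun y => funext fun v => ?_)
  rw [sw_comm]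

theorem isZ2_unit2 : st.IsZ2 cop cou (unit2 cou) := by
  have hB := bih_unit2 h
  refine ⟨isBihom_iff_bih.2 hB, fun X => by simp [unit2], fun X => by simp [unit2],
    fun b X Y => ?_, fun X Y Z => ?_, unit2 cou, isBihom_iff_bih.2 hB, fun X Y => ?_,
    fun X Y => ?_⟩
  · simp only [unit2, ← mul_assoc, counit_mul_s h]
  · rw [cocL_eq h hB, cocR_eq h hB, twMul_unit2 h, twMul_unit2 h, unit2, unit2, mul_assoc]
  all_goals rw [unit2_conv2 h hB]

theorem coboundary_eq_gammaU {U V : L →ₗ[k] B} (hU : st.IsBimodMap U) (hV : st.IsBimodMap V)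
    (hVst : ∀ (b : B) (X : L), V (X * st.s b) = V (X * st.t b)) :
    st.coboundary cop U V = st.gammaU cop (unit2 cou) U V := by
  rw [gammaU_eq_conv2 h (bih_unit2 h) hU hV hVst, unit2_conv2 h hU.bih_mul]
  rfl

/-- Translation by `U` intertwines the twisted products of `Γ` and of its transform. -/
theorem twMul_transform {Γ Γ' : L → L → B} (hΓ : st.Bih Γ) {U V : L →ₗ[k] B}
    (hU : st.IsBimodMap U) (hV : st.IsBimodMap V)
    (hΓΓ' : ∀ X Y, Γ' X Y = U (st.twMul cop Γ (st.act cop V X) (st.act cop V Y))) (X Y : L) :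
    st.twMul cop Γ' X Y =
      st.act cop U (st.twMul cop Γ (st.act cop V X) (st.act cop V Y)) := by
  have hb : st.Bal2 (fun x x' y y' => st.s (U (st.twMul cop Γ x y)) * (x' * y')) := by
    simpa only [conv2_mul h hΓ hU] using (hΓ.conv2 h hU.bih_mul).bal2_twMul
  rw [act, sw_cop_twMul h hΓ hU.act_bal, sw_cop_act h hV (hb.sw_bal h _)]
  simp only [sw_cop_act h hV (hb.bal _ _), ← hΓΓ']
  rfl

theorem isZ2_gammaU {Γ : L → L → B} (hΓ : st.IsZ2 cop cou Γ) {U V : L →ₗ[k] B}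
    (hU : st.IsBimodMap U) (hV : st.IsBimodMap V) (hV1 : V 1 = 1)
    (hUst : ∀ (b : B) (X : L), U (X * st.s b) = U (X * st.t b))
    (hVst : ∀ (b : B) (X : L), V (X * st.s b) = V (X * st.t b))
    (hUV : st.cconv cop U V = cou) (hVU : st.cconv cop V U = cou) :
    st.IsZ2 cop cou (st.gammaU cop Γ U V) := by
  have hB := isBihom_iff_bih.1 hΓ.bihom
  have hA := hV.bih_mul_t hVst
  have hM := hU.bih_mul
  have hG := hB.conv2 h hM
  have hG' := hA.conv2 h hG
  have hval : ∀ X Y, st.conv2 cop (fun X Y => V (X * st.t (V Y)))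
      (st.conv2 cop Γ (fun X Y => U (X * Y))) X Y =
        U (st.twMul cop Γ (st.act cop V X) (st.act cop V Y)) := fun X Y => by
    rw [conv2_mul_t h hV hVst hG, conv2_mul h hB hU]
  have htw := twMul_transform h hB hU hV hval
  have hUact : ∀ X, U (st.act cop V X) = cou X := fun X => by rw [map_act hV hU, hVU]
  rw [gammaU_eq_conv2 h hB hU hV hVst]
  refine ⟨isBihom_iff_bih.2 hG', fun X => ?_, fun X => ?_, ?_, fun X Y Z => ?_, ?_⟩
  · rw [hval, act_one h hV hV1, one_twMul h hB hΓ.norm_left, hUact]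
  · rw [hval, act_one h hV hV1, twMul_one h hB hΓ.norm_right, hUact]
  · refine conv2_st_indep h hA hG (fun b X Y => by rw [hVst])
      (conv2_st_indep h hB hM hΓ.st_indep fun b X Y => ?_)
    rw [← mul_assoc, hUst, mul_assoc]
  · rw [cocL_eq h hG', cocR_eq h hG', hval, hval, htw, htw, act_act h hU hV hUV,
      act_act h hU hV hUV, twMul_assoc h hB hΓ.cocycle]
  · obtain ⟨Γi, hΓi, hi1, hi2⟩ := hΓ.inv
    have hBi := isBihom_iff_bih.1 hΓi
    have hi1 : st.conv2 cop Γ Γi = unit2 cou := funext fun X => funext (hi1 X)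
    have hi2 : st.conv2 cop Γi Γ = unit2 cou := funext fun X => funext (hi2 X)
    have hA' := hU.bih_mul_t hUst
    have hM' := hV.bih_mul
    have hN := hBi.conv2 h hA'
    refine ⟨_, isBihom_iff_bih.2 (hM'.conv2 h hN), fun X Y => congrFun (congrFun ?_ X) Y,
      fun X Y => congrFun (congrFun ?_ X) Y⟩
    · rw [conv2_assoc h hA hG (hM'.conv2 h hN), conv2_assoc h hB hM (hM'.conv2 h hN),
        ← conv2_assoc h hM hM' hN, conv2_mul_mul h hU hV hUV, unit2_conv2 h hN,
        ← conv2_assoc h hB hBi hA', hi1, unit2_conv2 h hA',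
        conv2_mul_t_mul_t h hV hU hVst hUst hVU]
    · rw [conv2_assoc h hM' hN hG', conv2_assoc h hBi hA' hG', ← conv2_assoc h hA' hA hG,
        conv2_mul_t_mul_t h hU hV hUst hVst hUV, unit2_conv2 h hG,
        ← conv2_assoc h hBi hB hM, hi2, unit2_conv2 h hM, conv2_mul_mul h hV hU hVU]

end Twist

end BgdST

/-- Let `L` be a left bialgebroid over `B`.  For any `U ∈ C¹(L,B)` with
convolution inverse `U⁻¹`, the map `∂U(X,Y) = U⁻¹(X₍₁₎ t(U⁻¹(Y₍₁₎))) U(X₍₂₎Y₍₂₎)` is a 2-cocycle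
in `Z²(L,B)`; and more generally, if `Γ ∈ Z²(L,B)` then
`Γ^U(X,Y) = U⁻¹(X₍₁₎ t(U⁻¹(Y₍₁₎))) Γ(X₍₂₎,Y₍₂₎) U(X₍₃₎Y₍₃₎)` is again a 2-cocycle in `Z²(L,B)`. -/
theorem coboundary_and_transform_are_cocycles
    {k : Type*} [Field k] {B L : Type*} [Ring B] [Algebra k B] [Ring L] [Algebra k L]
    (st : BgdST k B L) (cop : L →ₗ[k] st.T2) (cou : L →ₗ[k] B)
    (hbgd : st.IsLeftBialgebroid cop cou)
    (U Ui : L →ₗ[k] B) (hU : st.IsC1 cop cou U) (hUi : st.IsC1 cop cou Ui)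
    (h1 : st.cconv cop U Ui = cou) (h2 : st.cconv cop Ui U = cou) :
    st.IsZ2 cop cou (st.coboundary cop U Ui) ∧
    (∀ Γ : L → L → B, st.IsZ2 cop cou Γ → st.IsZ2 cop cou (st.gammaU cop Γ U Ui)) := by
  have hΓ : ∀ Γ : L → L → B, st.IsZ2 cop cou Γ → st.IsZ2 cop cou (st.gammaU cop Γ U Ui) :=
    fun Γ hΓ => BgdST.isZ2_gammaU hbgd hΓ hU.2.1 hUi.2.1 hUi.1 hU.2.2.1 hUi.2.2.1 h1 h2
  refine ⟨?_, hΓ⟩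
  rw [BgdST.coboundary_eq_gammaU hbgd hU.2.1 hUi.2.1 hUi.2.2.1]
  exact hΓ _ (BgdST.isZ2_unit2 hbgd)
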